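/- Let λ > 1, ν > 0 and 0 < μ₁ < μ₂ with μ₁ϱ(λ) ≤ ν. Then the supremum values are strictly monotone in the impulse: S_{μ₁,ν,λ} < S_{μ₂,ν,λ}. -/

import Mathlib

open MeasureTheory Real Filter

noncomputable section

/-- The upper half plane `Π = {x ∈ ℝ² : x₂ > 0}`. -/
def UHP : Set (ℝ × ℝ) := {x | 0 < x.2}

/-- Euclidean norm of a point of `ℝ²`. -/
def rad (x : ℝ × ℝ) : ℝ := Real.sqrt (x.1 ^ 2 + x.2 ^ 2)

/-- Modified Bessel function of the second kind of order `0`: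
`K₀(r) = ∫₀^∞ exp(-r cosh t) dt`. -/
def K0 (r : ℝ) : ℝ := ∫ t in Set.Ioi (0 : ℝ), Real.exp (-(r * Real.cosh t))

/-- Fundamental solution `G(x,y) = (1/2π) K₀(|x-y|)` of `−Δ + Id` on `ℝ²`. -/
def Gker (x y : ℝ × ℝ) : ℝ := (1 / (2 * Real.pi)) * K0 (rad (x - y))

/-- Reflection `x̄ = (x₁, −x₂)` across the `x₁`-axis. -/
def reflPt (x : ℝ × ℝ) : ℝ × ℝ := (x.1, -x.2)

/-- Green's function `G_Π(x,y) = G(x,y) − G(x̄,y)` of `−Δ + Id` on the half plane. -/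
def GUHP (x y : ℝ × ℝ) : ℝ := Gker x y - Gker (reflPt x) y

/-- The operator `𝒢ω(x) = ∫_Π G_Π(x,y) ω(y) dy`. -/
def Gop (ω : ℝ × ℝ → ℝ) (x : ℝ × ℝ) : ℝ := ∫ y in UHP, GUHP x y * ω y

/-- Kinetic energy `E(ω) = (1/2) ∫_Π ω 𝒢ω`. -/
def kineticE (ω : ℝ × ℝ → ℝ) : ℝ := (1 / 2) * ∫ x in UHP, ω x * Gop ω x

/-- Impulse `I(ω) = ∫_Π x₂ ω dx`. -/
def impulse (ω : ℝ × ℝ → ℝ) : ℝ := ∫ x in UHP, x.2 * ω x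

/-- `L¹(Π)` norm. -/
def normL1 (f : ℝ × ℝ → ℝ) : ℝ := ∫ x in UHP, |f x|

/-- `L²(Π)` norm. -/
def normL2 (f : ℝ × ℝ → ℝ) : ℝ := (∫ x in UHP, (f x) ^ 2) ^ ((1 : ℝ) / 2)

/-- `L^s(Π)` norm. -/
def normLs (s : ℝ) (f : ℝ × ℝ → ℝ) : ℝ := (∫ x in UHP, |f x| ^ s) ^ (1 / s)

/-- Nonnegative member of `L¹(Π) ∩ L²(Π)`. -/
def NonnegL1L2 (ω : ℝ × ℝ → ℝ) : Prop :=
  (∀ x ∈ UHP, 0 ≤ ω x) ∧ IntegrableOn ω UHP ∧ IntegrableOn (fun x => (ω x) ^ 2) UHP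

/-- Steiner symmetry in the `x₁` variable. -/
def SteinerSym (f : ℝ × ℝ → ℝ) : Prop :=
  (∀ x : ℝ × ℝ, f (-x.1, x.2) = f x) ∧
  ∀ x₂ : ℝ, 0 < x₂ → AntitoneOn (fun x₁ => f (x₁, x₂)) (Set.Ioi (0 : ℝ))

/-- The admissible class `𝒜_{μ,ν}`. -/
def InAdm (μ ν : ℝ) (ω : ℝ × ℝ → ℝ) : Prop :=
  (∀ x ∈ UHP, 0 ≤ ω x) ∧ IntegrableOn ω UHP ∧ IntegrableOn (fun x => (ω x) ^ 2) UHP ∧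
  IntegrableOn (fun x => x.2 * ω x) UHP ∧
  impulse ω = μ ∧ (∫ x in UHP, ω x) ≤ ν

/-- The energy functional `ℰ_λ(ω) = E(ω) − (1/(2λ)) ∫_Π ω²`. -/
def Efun (lam : ℝ) (ω : ℝ × ℝ → ℝ) : ℝ :=
  kineticE ω - (1 / (2 * lam)) * ∫ x in UHP, (ω x) ^ 2

/-- The supremum `S_{μ,ν,λ} = sup_{ω ∈ 𝒜_{μ,ν}} ℰ_λ(ω)`. -/
def Sval (lam μ ν : ℝ) : ℝ := sSup {s | ∃ ω, InAdm μ ν ω ∧ s = Efun lam ω}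

/-- `ω` is a maximizer, i.e. `ω ∈ Σ_{μ,ν,λ}`. -/
def IsMaximizer (lam μ ν : ℝ) (ω : ℝ × ℝ → ℝ) : Prop :=
  InAdm μ ν ω ∧ Efun lam ω = Sval lam μ ν

/-- Bessel function of the first kind of order one. -/
def J1 (r : ℝ) : ℝ :=
  ∑' k : ℕ, ((-1 : ℝ) ^ k / ((Nat.factorial k : ℝ) * (Nat.factorial (k + 1) : ℝ))) *
    (r / 2) ^ (2 * k + 1)

/-- Modified Bessel function of the second kind of order one. -/
def K1 (r : ℝ) : ℝ := ∫ t in Set.Ioi (0 : ℝ), Real.exp (-(r * Real.cosh t)) * Real.cosh t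

/-- The set of `t > 0` with `J₁(√(λ−1) t) ≠ 0` solving the transcendental equation
`t (K₁'(t)/K₁(t) + (λ−1)^{-1/2} J₁'(√(λ−1)t)/J₁(√(λ−1)t)) = λ/(λ−1)`. -/
def aSet (lam : ℝ) : Set ℝ :=
  {t | 0 < t ∧ J1 (Real.sqrt (lam - 1) * t) ≠ 0 ∧
    t * (deriv K1 t / K1 t +
      (1 / Real.sqrt (lam - 1)) *
        (deriv J1 (Real.sqrt (lam - 1) * t) / J1 (Real.sqrt (lam - 1) * t))) = lam / (lam - 1)}

/-- The smallest positive solution `a = a(λ)`. -/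
def aLam (lam : ℝ) : ℝ := sInf (aSet lam)

/-- The stream function `Ψ_L^{λ,W}` of the Lamb dipole, written in polar coordinates
`x₁ = r cos θ`, `x₂ = r sin θ` (so that `sin θ = x₂ / r`). -/
def PsiL (lam W : ℝ) (x : ℝ × ℝ) : ℝ :=
  if rad x ≤ aLam lam then
    ((-(W * aLam lam / (lam - 1)) / J1 (Real.sqrt (lam - 1) * aLam lam)) *
        J1 (Real.sqrt (lam - 1) * rad x) + (W * lam / (lam - 1)) * rad x) * (x.2 / rad x)
  else (W * aLam lam / K1 (aLam lam)) * K1 (rad x) * (x.2 / rad x)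

/-- The Lamb dipole `ω_L^{λ,W} = λ (Ψ_L^{λ,W} − W x₂)₊` restricted to `Π`. -/
def omegaL (lam W : ℝ) (x : ℝ × ℝ) : ℝ :=
  if 0 < x.2 then lam * max (PsiL lam W x - W * x.2) 0 else 0

/-- `ϱ(λ) = (∫_Π ω_L^{λ,1} dx) / I(ω_L^{λ,1})`. -/
def varrho (lam : ℝ) : ℝ := (∫ x in UHP, omegaL lam 1 x) / impulse (omegaL lam 1)

/-- The Laplacian on `ℝ²`, written coordinatewise. -/
def lap (ψ : ℝ × ℝ → ℝ) (x : ℝ × ℝ) : ℝ :=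
  deriv (deriv fun t => ψ (t, x.2)) x.1 + deriv (deriv fun t => ψ (x.1, t)) x.2

/-- Distance (in `L¹ ∩ L²` plus weighted `L¹`) from `ζ` to a set of functions `S`. -/
def distToSet (S : Set ((ℝ × ℝ) → ℝ)) (ζ : (ℝ × ℝ) → ℝ) : ℝ :=
  sInf {d | ∃ ω ∈ S, d = normL1 (fun x => ζ x - ω x) + normL2 (fun x => ζ x - ω x) +
    normL1 (fun x => x.2 * (ζ x - ω x))}

end

/-! ### The kernel `K0` -/

lemma cosh_lower {t : ℝ} (ht : 0 ≤ t) : 1 + t ^ 2 / 2 ≤ Real.cosh t := by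
  have h1 : Real.cosh t = 1 + 2 * Real.sinh (t / 2) ^ 2 := by
    have := Real.cosh_two_mul (t / 2)
    have h2 := Real.cosh_sq (t / 2)
    have h3 : 2 * (t / 2) = t := by ring
    rw [h3] at this
    rw [this, h2]; ring
  have h2 : t / 2 ≤ Real.sinh (t / 2) := Real.self_le_sinh_iff.mpr (by positivity)
  rw [h1]
  nlinarith

lemma K0_integrand_le {r t : ℝ} (hr : 0 < r) (ht : 0 ≤ t) :
    Real.exp (-(r * Real.cosh t)) ≤ Real.exp (-r) * Real.exp (-(r / 2) * t ^ 2) := by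
  rw [← Real.exp_add]
  apply Real.exp_le_exp.mpr
  have := cosh_lower ht
  nlinarith

lemma K0_dom_integrable {r : ℝ} (hr : 0 < r) :
    IntegrableOn (fun t : ℝ => Real.exp (-r) * Real.exp (-(r / 2) * t ^ 2)) (Set.Ioi 0) :=
  ((integrable_exp_neg_mul_sq (by positivity : 0 < r / 2)).const_mul _).integrableOn

lemma K0_integrable {r : ℝ} (hr : 0 < r) :
    IntegrableOn (fun t : ℝ => Real.exp (-(r * Real.cosh t))) (Set.Ioi 0) := by
  refine Integrable.mono' (K0_dom_integrable hr) ?_ ?_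
  · exact (by fun_prop : Continuous (fun t : ℝ => Real.exp (-(r * Real.cosh t)))).aestronglyMeasurable
  · refine (ae_restrict_iff' measurableSet_Ioi).mpr (Eventually.of_forall fun t ht => ?_)
    rw [Real.norm_of_nonneg (Real.exp_pos _).le]
    exact K0_integrand_le hr (le_of_lt ht)

lemma K0_nonneg (r : ℝ) : 0 ≤ K0 r := integral_nonneg fun _ => (Real.exp_pos _).le

lemma K0_pos {r : ℝ} (hr : 0 < r) : 0 < K0 r := by
  unfold K0
  rw [setIntegral_pos_iff_support_of_nonneg_ae (Eventually.of_forall fun _ => (Real.exp_pos _).le)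
    (K0_integrable hr)]
  have : Function.support (fun t : ℝ => Real.exp (-(r * Real.cosh t))) = Set.univ := by
    ext t; simp [Real.exp_ne_zero]
  rw [this]; simp

lemma K0_zero : K0 0 = 0 := by
  unfold K0
  simp [integral_const, Measure.real]

lemma K0_le {r : ℝ} (hr : 0 < r) : K0 r ≤ Real.exp (-r) * (2 * r ^ (-(1 / 2) : ℝ)) := by
  have h1 : K0 r ≤ ∫ t in Set.Ioi (0 : ℝ), Real.exp (-r) * Real.exp (-(r / 2) * t ^ 2) := by
    refine setIntegral_mono_on (K0_integrable hr) (K0_dom_integrable hr) measurableSet_Ioi ?_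
    intro t ht
    exact K0_integrand_le hr (le_of_lt ht)
  refine h1.trans ?_
  rw [integral_const_mul, integral_gaussian_Ioi]
  gcongr
  have h2 : π / (r / 2) = (2 * π) * r⁻¹ := by field_simp
  rw [h2, Real.sqrt_mul (by positivity), Real.rpow_neg hr.le, ← Real.sqrt_eq_rpow, Real.sqrt_inv]
  have h3 : Real.sqrt (2 * π) ≤ 4 := by
    rw [Real.sqrt_le_left (by norm_num)]
    have := Real.pi_le_four
    linarith
  have h4 : 0 ≤ (Real.sqrt r)⁻¹ := by positivity
  nlinarith

lemma K0_add_le {a τ : ℝ} (ha : 0 < a) (hτ : 0 ≤ τ) : K0 (a + τ) ≤ Real.exp (-τ) * K0 a := by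
  unfold K0
  rw [← integral_const_mul]
  refine setIntegral_mono_on (K0_integrable (by positivity)) ((K0_integrable ha).const_mul _)
    measurableSet_Ioi ?_
  intro t _
  rw [← Real.exp_add]
  apply Real.exp_le_exp.mpr
  have := Real.one_le_cosh t
  nlinarith

lemma K0_anti {a b : ℝ} (ha : 0 < a) (hab : a ≤ b) : K0 b ≤ K0 a := by
  have h := K0_add_le ha (sub_nonneg.mpr hab)
  rw [add_sub_cancel] at h
  have h2 : Real.exp (-(b - a)) ≤ 1 := Real.exp_le_one_iff.mpr (by linarith)
  have := K0_nonneg a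
  nlinarith

lemma K0_measurable : Measurable K0 := by
  have : StronglyMeasurable (fun p : ℝ × ℝ => Real.exp (-(p.1 * Real.cosh p.2))) :=
    (by fun_prop : Continuous (fun p : ℝ × ℝ => Real.exp (-(p.1 * Real.cosh p.2)))).stronglyMeasurable
  exact (StronglyMeasurable.integral_prod_right (ν := volume.restrict (Set.Ioi (0:ℝ))) this).measurable

lemma rad_measurable : Measurable rad := by
  unfold rad; fun_prop

lemma rad_nonneg (x : ℝ × ℝ) : 0 ≤ rad x := Real.sqrt_nonneg _

/-- Radial integrals. -/
lemma lintegral_rad (g : ℝ → ENNReal) (hg : Measurable g) :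
    ∫⁻ x : ℝ × ℝ, g (rad x) =
      ENNReal.ofReal (2 * π) * ∫⁻ r in Set.Ioi (0 : ℝ), ENNReal.ofReal r * g r := by
  rw [← lintegral_comp_polarCoord_symm]
  have h1 : ∀ p ∈ polarCoord.target,
      ENNReal.ofReal p.1 • g (rad (polarCoord.symm p)) = (ENNReal.ofReal p.1 * g p.1) * 1 := by
    intro p hp
    have hp1 : 0 < p.1 := hp.1
    have : rad (polarCoord.symm p) = p.1 := by
      unfold rad
      simp only [polarCoord_symm_apply]
      rw [show (p.1 * Real.cos p.2) ^ 2 + (p.1 * Real.sin p.2) ^ 2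
        = p.1 ^ 2 * (Real.sin p.2 ^ 2 + Real.cos p.2 ^ 2) by ring, Real.sin_sq_add_cos_sq, mul_one]
      exact Real.sqrt_sq hp1.le
    rw [this, smul_eq_mul, mul_one]
  rw [setLIntegral_congr_fun polarCoord.open_target.measurableSet h1]
  rw [polarCoord_target, Measure.volume_eq_prod, ← Measure.prod_restrict,
    lintegral_prod_mul (f := fun r => ENNReal.ofReal r * g r) (g := fun _ => 1)
      (by fun_prop) (by fun_prop)]
  rw [mul_comm]
  congr 1
  simp only [lintegral_const, one_mul, Measure.restrict_apply_univ, Real.volume_Ioo]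
  congr 1; ring

lemma lint_r_exp {b : ℝ} (hb : 0 < b) :
    ∫⁻ r in Set.Ioi (0 : ℝ), ENNReal.ofReal (r * Real.exp (-(r * b))) = ENNReal.ofReal (1 / b ^ 2) := by
  have h1 := Real.integral_rpow_mul_exp_neg_mul_Ioi (a := 2) (by norm_num) hb
  have h2 : IntegrableOn (fun t : ℝ => t * Real.exp (-(t * b))) (Set.Ioi 0) := by
    have := integrableOn_rpow_mul_exp_neg_mul_rpow (p := 1) (s := 1) (b := b) (by norm_num)
      (by norm_num) hb
    refine this.congr_fun ?_ measurableSet_Ioi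
    intro t ht
    simp only [Real.rpow_one]
    congr 2; ring
  rw [← ofReal_integral_eq_lintegral_ofReal h2]
  · congr 1
    have h3 : ∫ t in Set.Ioi (0:ℝ), t * Real.exp (-(t * b)) =
        ∫ t in Set.Ioi (0:ℝ), t ^ ((2:ℝ) - 1) * Real.exp (-(b * t)) := by
      refine setIntegral_congr_fun measurableSet_Ioi fun t ht => ?_
      rw [show (2:ℝ) - 1 = 1 by norm_num, Real.rpow_one, mul_comm b t]
    rw [h3, h1]
    rw [show (2:ℝ) = 1 + 1 by norm_num, Real.Gamma_add_one (by norm_num)]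
    norm_num
  · refine (ae_restrict_iff' measurableSet_Ioi).mpr (Eventually.of_forall fun t ht => ?_)
    have : 0 < t := ht
    simp only [Pi.zero_apply]; positivity

lemma lint_cosh :
    ∫⁻ t in Set.Ioi (0 : ℝ), ENNReal.ofReal (1 / Real.cosh t ^ 2) = 1 := by
  have hd : ∀ x ∈ Set.Ici (0:ℝ),
      HasDerivAt (fun t => Real.sinh t / Real.cosh t) (1 / Real.cosh x ^ 2) x := by
    intro x _
    have h := (Real.hasDerivAt_sinh x).div (Real.hasDerivAt_cosh x) (Real.cosh_pos x).ne'
    have h2 : (Real.cosh x * Real.cosh x - Real.sinh x * Real.sinh x) = 1 := by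
      have := Real.cosh_sq x
      nlinarith
    rw [h2] at h
    exact h
  have hnn : ∀ x ∈ Set.Ioi (0:ℝ), 0 ≤ 1 / Real.cosh x ^ 2 := fun x _ => by positivity
  have hl : Tendsto (fun t => Real.sinh t / Real.cosh t) atTop (nhds 1) := by
    have h1 : (fun t => Real.sinh t / Real.cosh t)
        = fun t => 1 - Real.exp (-t) / Real.cosh t := by
      funext t
      rw [← Real.cosh_sub_sinh]
      have := (Real.cosh_pos t).ne'
      field_simp; ring
    rw [h1]
    have h2 : Tendsto (fun t : ℝ => Real.exp (-t) / Real.cosh t) atTop (nhds 0) := by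
      refine squeeze_zero (fun t => by have := Real.cosh_pos t; positivity) (fun t => ?_)
        (Real.tendsto_exp_neg_atTop_nhds_zero)
      exact div_le_self (Real.exp_pos _).le (Real.one_le_cosh t)
    simpa using h2.const_sub 1
  have hi := integrableOn_Ioi_deriv_of_nonneg' hd hnn hl
  have hv := integral_Ioi_of_hasDerivAt_of_nonneg' hd hnn hl
  rw [← ofReal_integral_eq_lintegral_ofReal hi
    ((ae_restrict_iff' measurableSet_Ioi).mpr (Eventually.of_forall hnn)), hv]
  simp

/-- Total mass of `K₀`. -/
lemma lint_K0 : ∫⁻ x : ℝ × ℝ, ENNReal.ofReal (K0 (rad x)) = ENNReal.ofReal (2 * π) := by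
  rw [lintegral_rad (fun r => ENNReal.ofReal (K0 r)) (K0_measurable.ennreal_ofReal)]
  have h1 : ∀ r ∈ Set.Ioi (0:ℝ), ENNReal.ofReal r * ENNReal.ofReal (K0 r) =
      ∫⁻ t in Set.Ioi (0:ℝ), ENNReal.ofReal (r * Real.exp (-(r * Real.cosh t))) := by
    intro r hr
    have hr' : 0 < r := hr
    rw [← ENNReal.ofReal_mul hr'.le, K0, ← integral_const_mul,
      ofReal_integral_eq_lintegral_ofReal ((K0_integrable hr').const_mul r)]
    exact Eventually.of_forall fun t => by simp only [Pi.zero_apply]; positivity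
  rw [setLIntegral_congr_fun measurableSet_Ioi h1]
  rw [lintegral_lintegral_swap]
  · have h2 : ∀ t ∈ Set.Ioi (0:ℝ),
        ∫⁻ r in Set.Ioi (0 : ℝ), ENNReal.ofReal (r * Real.exp (-(r * Real.cosh t)))
          = ENNReal.ofReal (1 / Real.cosh t ^ 2) := fun t _ => lint_r_exp (Real.cosh_pos t)
    rw [setLIntegral_congr_fun measurableSet_Ioi h2, lint_cosh, mul_one]
  · apply Measurable.aemeasurable
    apply Measurable.ennreal_ofReal
    exact (by fun_prop : Continuous (fun p : ℝ × ℝ =>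
      p.1 * Real.exp (-(p.1 * Real.cosh p.2)))).measurable

lemma integrable_of_lint {f : ℝ × ℝ → ℝ} (hm : Measurable f) (h0 : ∀ x, 0 ≤ f x)
    (h : ∫⁻ x, ENNReal.ofReal (f x) ≠ ⊤) : Integrable f := by
  refine ⟨hm.aestronglyMeasurable, ?_⟩
  rw [hasFiniteIntegral_iff_ofReal (Eventually.of_forall h0)]
  exact lt_top_iff_ne_top.mpr h

lemma K0rad_integrable : Integrable (fun x : ℝ × ℝ => K0 (rad x)) :=
  integrable_of_lint (K0_measurable.comp rad_measurable) (fun _ => K0_nonneg _)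
    (by rw [lint_K0]; exact ENNReal.ofReal_ne_top)

lemma K0rad_integral : ∫ x : ℝ × ℝ, K0 (rad x) = 2 * π := by
  rw [integral_eq_lintegral_of_nonneg_ae (Eventually.of_forall fun _ => K0_nonneg _)
    K0rad_integrable.aestronglyMeasurable, lint_K0, ENNReal.toReal_ofReal (by positivity)]

/-- Singular comparison function. -/
noncomputable def hsing (x : ℝ × ℝ) : ℝ := rad x ^ (-(3 / 4) : ℝ) * Real.exp (-rad x)

/-- Regular comparison function. -/
noncomputable def esing (x : ℝ × ℝ) : ℝ := Real.exp (-rad x)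

lemma hsing_nonneg (x : ℝ × ℝ) : 0 ≤ hsing x :=
  mul_nonneg (Real.rpow_nonneg (rad_nonneg x) _) (Real.exp_pos _).le

lemma esing_nonneg (x : ℝ × ℝ) : 0 ≤ esing x := (Real.exp_pos _).le

lemma hsing_measurable : Measurable hsing :=
  (rad_measurable.pow_const _).mul (rad_measurable.neg.exp)

lemma esing_measurable : Measurable esing := rad_measurable.neg.exp

lemma hsing_sq_integrable : Integrable (fun x => hsing x ^ 2) := by
  apply integrable_of_lint (hsing_measurable.pow_const 2) (fun x => sq_nonneg _)
  have := lintegral_rad (fun r => ENNReal.ofReal ((r ^ (-(3 / 4) : ℝ) * Real.exp (-r)) ^ 2))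
    (by fun_prop)
  unfold hsing
  rw [this]
  refine ENNReal.mul_ne_top ENNReal.ofReal_ne_top ?_
  have h1 : ∀ r ∈ Set.Ioi (0:ℝ), ENNReal.ofReal r *
      ENNReal.ofReal ((r ^ (-(3 / 4) : ℝ) * Real.exp (-r)) ^ 2)
      = ENNReal.ofReal (r ^ (-(1/2):ℝ) * Real.exp (-2 * r ^ (1:ℝ))) := by
    intro r hr
    have hr' : 0 < r := hr
    rw [← ENNReal.ofReal_mul hr'.le]
    congr 1
    rw [mul_pow, ← Real.exp_nat_mul, ← Real.rpow_natCast, ← Real.rpow_mul hr'.le, ← mul_assoc]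
    congr 1
    · nth_rewrite 1 [← Real.rpow_one r]
      rw [← Real.rpow_add hr']; norm_num
    · simp
  rw [setLIntegral_congr_fun measurableSet_Ioi h1]
  have h2 := integrableOn_rpow_mul_exp_neg_mul_rpow (p := 1) (s := -(1/2)) (b := 2) (by norm_num)
      (by norm_num) (by norm_num)
  exact ((hasFiniteIntegral_iff_ofReal ((ae_restrict_iff' measurableSet_Ioi).mpr
    (Eventually.of_forall fun t ht => by
      have : 0 < t := ht
      simp only [Pi.zero_apply]; positivity))).mp h2.2).ne

lemma esing_sq_integrable : Integrable (fun x => esing x ^ 2) := by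
  apply integrable_of_lint (esing_measurable.pow_const 2) (fun x => sq_nonneg _)
  have := lintegral_rad (fun r => ENNReal.ofReal ((Real.exp (-r)) ^ 2)) (by fun_prop)
  unfold esing
  rw [this]
  refine ENNReal.mul_ne_top ENNReal.ofReal_ne_top ?_
  have h1 : ∀ r ∈ Set.Ioi (0:ℝ), ENNReal.ofReal r * ENNReal.ofReal ((Real.exp (-r)) ^ 2)
      = ENNReal.ofReal (r * Real.exp (-(r * 2))) := by
    intro r hr
    have hr' : 0 < r := hr
    rw [← ENNReal.ofReal_mul hr'.le, ← Real.exp_nat_mul]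
    congr 3; push_cast; ring
  rw [setLIntegral_congr_fun measurableSet_Ioi h1, lint_r_exp (by norm_num)]
  exact ENNReal.ofReal_ne_top

lemma K0_split (x : ℝ × ℝ) {η : ℝ} (hη : 0 < η) :
    K0 (rad x) ≤ 2 * (η * hsing x + (1 / η ^ 2) * esing x) := by
  rcases (rad_nonneg x).eq_or_lt with h | h
  · rw [← h, K0_zero]
    have := hsing_nonneg x
    have := esing_nonneg x
    positivity
  · refine (K0_le h).trans ?_
    unfold hsing esing
    set r := rad x
    set u := r ^ (-(1/4) : ℝ) with hu
    have hu0 : 0 < u := by positivity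
    have h2 : r ^ (-(1/2):ℝ) = u ^ 2 := by
      rw [hu, ← Real.rpow_natCast, ← Real.rpow_mul h.le]; norm_num
    have h3 : r ^ (-(3/4):ℝ) = u ^ 3 := by
      rw [hu, ← Real.rpow_natCast, ← Real.rpow_mul h.le]; norm_num
    rw [h2, h3]
    have key : u ^ 2 ≤ η * u ^ 3 + 1 / η ^ 2 := by
      rcases le_total (η * u) 1 with h4 | h4
      · have : u ^ 2 ≤ 1 / η ^ 2 := by
          rw [le_div_iff₀ (by positivity)]
          have : 0 < η * u := by positivity
          nlinarith
        have : 0 ≤ η * u ^ 3 := by positivity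
        linarith
      · have : u ^ 2 * 1 ≤ u ^ 2 * (η * u) := by gcongr
        have : 0 ≤ 1 / η ^ 2 := by positivity
        nlinarith
    have := Real.exp_pos (-r)
    nlinarith

lemma K0rad_sq_integrable : Integrable (fun x : ℝ × ℝ => K0 (rad x) ^ 2) := by
  refine Integrable.mono' ((hsing_sq_integrable.add esing_sq_integrable).const_mul 8)
    ((K0_measurable.comp rad_measurable).pow_const 2).aestronglyMeasurable
    (Eventually.of_forall fun x => ?_)
  rw [Real.norm_of_nonneg (sq_nonneg _)]
  have h1 := K0_split x one_pos
  have h2 := K0_nonneg (rad x)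
  simp only [Pi.add_apply]
  have := sq_nonneg (hsing x - esing x)
  have h3 : K0 (rad x) ^ 2 ≤ (2 * (1 * hsing x + (1 / 1 ^ 2) * esing x)) ^ 2 := by gcongr
  nlinarith

/-! ### Double integrals -/

lemma prod_int_shift {W g : ℝ × ℝ → ℝ} {φ : ℝ × ℝ → ℝ × ℝ} (hW : Integrable W)
    (hg : Integrable g) (hgm : Measurable g) (hφ : Measurable φ) :
    Integrable (fun p : (ℝ × ℝ) × (ℝ × ℝ) => W p.1 * g (φ p.1 - p.2)) ∧
    ∫ p : (ℝ × ℝ) × (ℝ × ℝ), W p.1 * g (φ p.1 - p.2) = (∫ x, W x) * ∫ x, g x := by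
  have hm : AEStronglyMeasurable (fun p : (ℝ × ℝ) × (ℝ × ℝ) => W p.1 * g (φ p.1 - p.2))
      (volume.prod volume) := by
    refine AEStronglyMeasurable.mul (hW.aestronglyMeasurable.comp_fst) ?_
    exact (hgm.comp ((hφ.comp measurable_fst).sub measurable_snd)).aestronglyMeasurable
  have hI : Integrable (fun p : (ℝ × ℝ) × (ℝ × ℝ) => W p.1 * g (φ p.1 - p.2))
      (volume.prod volume) := by
    rw [integrable_prod_iff hm]
    refine ⟨Eventually.of_forall fun x => (hg.comp_sub_left (φ x)).const_mul (W x), ?_⟩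
    have h1 : (fun x => ∫ y, ‖W x * g (φ x - y)‖) = fun x => ‖W x‖ * ∫ y, ‖g y‖ := by
      funext x
      simp_rw [norm_mul]
      rw [integral_const_mul, integral_sub_left_eq_self (fun y => ‖g y‖)]
    simp only
    rw [h1]
    exact hW.norm.mul_const _
  refine ⟨hI, ?_⟩
  rw [Measure.volume_eq_prod, integral_prod _ hI]
  have h1 : (fun x => ∫ y, W x * g (φ x - y)) = fun x => W x * ∫ y, g y := by
    funext x
    rw [integral_const_mul, integral_sub_left_eq_self (fun y => g y)]
  simp only
  rw [h1, integral_mul_const]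

/-- Well-behaved densities on the whole plane, supported in the half plane. -/
structure Good (W : ℝ × ℝ → ℝ) : Prop where
  nn : ∀ x, 0 ≤ W x
  supp : ∀ x, x ∉ UHP → W x = 0
  int : Integrable W
  int2 : Integrable (fun x => W x ^ 2)
  int1 : Integrable (fun x => x.2 * W x)

lemma Good.pair_bound {W : ℝ × ℝ → ℝ} (hW : Good W) {k : ℝ × ℝ → ℝ} {φ : ℝ × ℝ → ℝ × ℝ}
    (hk : Measurable k) (hk0 : ∀ x, 0 ≤ k x) (hk2 : Integrable (fun x => k x ^ 2))
    (hφ : Measurable φ) :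
    Integrable (fun p : (ℝ × ℝ) × (ℝ × ℝ) => W p.1 * W p.2 * k (φ p.1 - p.2)) ∧
    ∀ θ : ℝ, 0 < θ → ∫ p : (ℝ × ℝ) × (ℝ × ℝ), W p.1 * W p.2 * k (φ p.1 - p.2) ≤
      (1 / 2) * ((∫ x, W x) * (θ * (∫ x, W x ^ 2) + (1 / θ) * ∫ x, k x ^ 2)) := by
  have hB := prod_int_shift hW.int hk2 (hk.pow_const 2) hφ
  have hC : Integrable (fun p : (ℝ × ℝ) × (ℝ × ℝ) => W p.1 * W p.2 ^ 2) :=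
    hW.int.mul_prod hW.int2
  have hCv : ∫ p : (ℝ × ℝ) × (ℝ × ℝ), W p.1 * W p.2 ^ 2 = (∫ x, W x) * ∫ x, W x ^ 2 :=
    integral_prod_mul W (fun x => W x ^ 2)
  have hD : ∀ θ : ℝ, Integrable (fun p : (ℝ × ℝ) × (ℝ × ℝ) =>
      (θ / 2) * (W p.1 * W p.2 ^ 2) + (1 / θ / 2) * (W p.1 * k (φ p.1 - p.2) ^ 2)) :=
    fun θ => (hC.const_mul _).add (hB.1.const_mul _)
  have hle : ∀ θ : ℝ, 0 < θ → ∀ p : (ℝ × ℝ) × (ℝ × ℝ), W p.1 * W p.2 * k (φ p.1 - p.2) ≤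
      (θ / 2) * (W p.1 * W p.2 ^ 2) + (1 / θ / 2) * (W p.1 * k (φ p.1 - p.2) ^ 2) := by
    intro θ hθ p
    have h1 := hW.nn p.1
    have h2 : W p.2 * k (φ p.1 - p.2) ≤
        (θ / 2) * W p.2 ^ 2 + (1 / θ / 2) * k (φ p.1 - p.2) ^ 2 := by
      have : (θ / 2) * W p.2 ^ 2 + (1 / θ / 2) * k (φ p.1 - p.2) ^ 2 - W p.2 * k (φ p.1 - p.2)
          = (1 / (2 * θ)) * (θ * W p.2 - k (φ p.1 - p.2)) ^ 2 := by
        field_simp; ring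
      have h3 : 0 ≤ (1 / (2 * θ)) * (θ * W p.2 - k (φ p.1 - p.2)) ^ 2 := by positivity
      linarith
    have := mul_le_mul_of_nonneg_left h2 h1
    linarith
  have hI : Integrable (fun p : (ℝ × ℝ) × (ℝ × ℝ) => W p.1 * W p.2 * k (φ p.1 - p.2)) := by
    refine Integrable.mono' (hD 1) ?_ (Eventually.of_forall fun p => ?_)
    · have h1 : Integrable (fun p : (ℝ × ℝ) × (ℝ × ℝ) => W p.1 * W p.2) :=
        hW.int.mul_prod hW.int
      exact h1.aestronglyMeasurable.mul
        (hk.comp ((hφ.comp measurable_fst).sub measurable_snd)).aestronglyMeasurable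
    · rw [Real.norm_of_nonneg (mul_nonneg (mul_nonneg (hW.nn _) (hW.nn _)) (hk0 _))]
      exact hle 1 one_pos p
  refine ⟨hI, fun θ hθ => ?_⟩
  refine (integral_mono hI (hD θ) (hle θ hθ)).trans (le_of_eq ?_)
  rw [integral_add (hC.const_mul _) (hB.1.const_mul _), integral_const_mul, integral_const_mul,
    hCv, hB.2]
  ring

lemma measurable_reflPt : Measurable reflPt := by unfold reflPt; fun_prop

lemma measurableSet_UHP : MeasurableSet UHP := by
  unfold UHP; exact measurableSet_lt measurable_const measurable_snd

/-- Interaction integral with kernel `K₀(|φ(x) - y|)`. -/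
noncomputable def Qint (φ : ℝ × ℝ → ℝ × ℝ) (W : ℝ × ℝ → ℝ) : ℝ :=
  ∫ p : (ℝ × ℝ) × (ℝ × ℝ), W p.1 * W p.2 * K0 (rad (φ p.1 - p.2))

lemma Good.Qint_integrable {W : ℝ × ℝ → ℝ} (hW : Good W) {φ : ℝ × ℝ → ℝ × ℝ}
    (hφ : Measurable φ) :
    Integrable (fun p : (ℝ × ℝ) × (ℝ × ℝ) => W p.1 * W p.2 * K0 (rad (φ p.1 - p.2))) :=
  (hW.pair_bound (k := fun x => K0 (rad x)) (K0_measurable.comp rad_measurable)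
    (fun _ => K0_nonneg _) K0rad_sq_integrable hφ).1

lemma Good.setInt {W : ℝ × ℝ → ℝ} (hW : Good W) {f : ℝ × ℝ → ℝ}
    (hf : ∀ x, W x = 0 → f x = 0) : ∫ x in UHP, f x = ∫ x, f x :=
  setIntegral_eq_integral_of_forall_compl_eq_zero fun x hx => hf x (hW.supp x hx)

lemma Good.Qint_nonneg {W : ℝ × ℝ → ℝ} (hW : Good W) {φ : ℝ × ℝ → ℝ × ℝ} :
    0 ≤ Qint φ W :=
  integral_nonneg fun _ => mul_nonneg (mul_nonneg (hW.nn _) (hW.nn _)) (K0_nonneg _)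

lemma Good.kineticE_eq {W : ℝ × ℝ → ℝ} (hW : Good W) :
    kineticE W = (1 / (4 * π)) * (Qint id W - Qint reflPt W) := by
  have h1 := hW.Qint_integrable measurable_id
  have h2 := hW.Qint_integrable measurable_reflPt
  unfold kineticE Gop
  rw [hW.setInt (fun x hx => by rw [hx, zero_mul])]
  have h3 : ∀ x, W x * ∫ y in UHP, GUHP x y * W y =
      ∫ y, (1 / (2 * π)) * (W x * W y * K0 (rad (id x - y))
        - W x * W y * K0 (rad (reflPt x - y))) := by
    intro x
    rw [hW.setInt (fun y hy => by rw [hy, mul_zero]), ← integral_const_mul]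
    congr 1; funext y
    unfold GUHP Gker
    simp only [id]; ring
  simp_rw [h3]
  have h4 : Integrable (fun p : (ℝ × ℝ) × (ℝ × ℝ) => (1 / (2 * π)) *
      (W p.1 * W p.2 * K0 (rad (id p.1 - p.2)) - W p.1 * W p.2 * K0 (rad (reflPt p.1 - p.2))))
      (volume.prod volume) := (h1.sub h2).const_mul _
  rw [← integral_prod (fun p : (ℝ × ℝ) × (ℝ × ℝ) => (1 / (2 * π)) *
      (W p.1 * W p.2 * K0 (rad (id p.1 - p.2)) - W p.1 * W p.2 * K0 (rad (reflPt p.1 - p.2)))) h4,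
    integral_const_mul, ← Measure.volume_eq_prod, integral_sub h1 h2]
  unfold Qint
  field_simp
  norm_num
  ring

lemma Good.Efun_eq {W : ℝ × ℝ → ℝ} (hW : Good W) (lam : ℝ) :
    Efun lam W = (1 / (4 * π)) * (Qint id W - Qint reflPt W)
      - (1 / (2 * lam)) * ∫ x, W x ^ 2 := by
  unfold Efun
  rw [hW.kineticE_eq, hW.setInt (fun x hx => by rw [hx]; simp)]

/-- Upward translation. -/
def shiftUp (s : ℝ) (W : ℝ × ℝ → ℝ) : ℝ × ℝ → ℝ := fun x => W (x - (0, s))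

lemma Good.shiftUp {W : ℝ × ℝ → ℝ} (hW : Good W) {s : ℝ} (hs : 0 ≤ s) : Good (shiftUp s W) where
  nn x := hW.nn _
  supp x hx := by
    apply hW.supp
    simp only [UHP, Set.mem_ofPred_eq, Prod.snd_sub, not_lt] at *
    linarith
  int := hW.int.comp_sub_right (0, s)
  int2 := hW.int2.comp_sub_right (0, s)
  int1 := by
    have := (hW.int1.comp_sub_right (0, s)).add ((hW.int.comp_sub_right (0, s)).const_mul s)
    refine this.congr (Eventually.of_forall fun x => ?_)
    simp only [_root_.shiftUp, Pi.add_apply, Prod.snd_sub]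
    ring

lemma shiftUp_Qint (s : ℝ) (W : ℝ × ℝ → ℝ) (φ : ℝ × ℝ → ℝ × ℝ) :
    Qint φ (shiftUp s W) = Qint (fun x => φ (x + (0, s)) - (0, s)) W := by
  have : (volume : Measure ((ℝ × ℝ) × (ℝ × ℝ))).IsAddRightInvariant :=
    inferInstanceAs ((volume : Measure (ℝ × ℝ)).prod (volume : Measure (ℝ × ℝ))).IsAddRightInvariant
  unfold Qint shiftUp
  rw [← integral_sub_right_eq_self (fun p : (ℝ × ℝ) × (ℝ × ℝ) =>
    W p.1 * W p.2 * K0 (rad (φ (p.1 + (0, s)) - (0, s) - p.2))) (((0, s), (0, s)))]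
  congr 1; funext p
  simp only [Prod.fst_sub, Prod.snd_sub, sub_add_cancel, sub_sub_sub_cancel_right]

lemma shiftUp_int (s : ℝ) (W : ℝ × ℝ → ℝ) : ∫ x, shiftUp s W x = ∫ x, W x :=
  integral_sub_right_eq_self W _

lemma shiftUp_int2 (s : ℝ) (W : ℝ × ℝ → ℝ) : ∫ x, shiftUp s W x ^ 2 = ∫ x, W x ^ 2 :=
  integral_sub_right_eq_self (fun x => W x ^ 2) _

lemma Good.shiftUp_int1 {W : ℝ × ℝ → ℝ} (hW : Good W) (s : ℝ) :
    ∫ x, x.2 * _root_.shiftUp s W x = (∫ x, x.2 * W x) + s * ∫ x, W x := by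
  have h := integral_sub_right_eq_self (μ := volume) (fun x : ℝ × ℝ => x.2 * W x + s * W x)
    ((0, s) : ℝ × ℝ)
  rw [integral_add hW.int1 (hW.int.const_mul s), integral_const_mul] at h
  rw [← h]
  congr 1; funext x
  simp only [_root_.shiftUp, Prod.snd_sub]; ring

/-- The shifted reflection. -/
def reflS (s : ℝ) (x : ℝ × ℝ) : ℝ × ℝ := reflPt x - (0, 2 * s)

lemma measurable_reflS (s : ℝ) : Measurable (reflS s) := by
  unfold reflS; exact measurable_reflPt.sub_const _

lemma Good.Efun_shiftUp {W : ℝ × ℝ → ℝ} (hW : Good W) (lam : ℝ) {s : ℝ} (hs : 0 ≤ s) :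
    Efun lam (_root_.shiftUp s W) = Efun lam W
      + (1 / (4 * π)) * (Qint reflPt W - Qint (reflS s) W) := by
  rw [(hW.shiftUp hs).Efun_eq, hW.Efun_eq, shiftUp_int2, shiftUp_Qint, shiftUp_Qint]
  have h1 : (fun x : ℝ × ℝ => id (x + (0, s)) - (0, s)) = id := by
    funext x; simp
  have h2 : (fun x : ℝ × ℝ => reflPt (x + (0, s)) - (0, s)) = reflS s := by
    funext x
    ext
    · simp [reflS, reflPt]
    · simp [reflS, reflPt]; ring
  rw [h1, h2]; ring

lemma InAdm.good {μ ν : ℝ} {ω : ℝ × ℝ → ℝ} (h : InAdm μ ν ω) : Good (UHP.indicator ω) where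
  nn x := Set.indicator_nonneg (fun x hx => h.1 x hx) x
  supp x hx := Set.indicator_of_notMem hx _
  int := (integrable_indicator_iff measurableSet_UHP).mpr h.2.1
  int2 := by
    refine ((integrable_indicator_iff measurableSet_UHP).mpr h.2.2.1).congr
      (Eventually.of_forall fun x => ?_)
    by_cases hx : x ∈ UHP <;> simp [hx]
  int1 := by
    refine ((integrable_indicator_iff measurableSet_UHP).mpr h.2.2.2.1).congr
      (Eventually.of_forall fun x => ?_)
    by_cases hx : x ∈ UHP <;> simp [hx]

lemma InAdm.indicator {μ ν : ℝ} {ω : ℝ × ℝ → ℝ} (h : InAdm μ ν ω) :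
    (∫ x, UHP.indicator ω x) ≤ ν ∧ (∫ x : ℝ × ℝ, x.2 * UHP.indicator ω x) = μ := by
  constructor
  · rw [integral_indicator measurableSet_UHP]; exact h.2.2.2.2.2
  · rw [← h.2.2.2.2.1, impulse, ← integral_indicator measurableSet_UHP]
    congr 1; funext x
    by_cases hx : x ∈ UHP <;> simp [hx]

lemma Efun_indicator (lam : ℝ) (ω : ℝ × ℝ → ℝ) : Efun lam (UHP.indicator ω) = Efun lam ω := by
  have hG : Gop (UHP.indicator ω) = Gop ω := by
    funext x
    refine setIntegral_congr_fun measurableSet_UHP fun y hy => ?_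
    simp only [Set.indicator_of_mem hy]
  unfold Efun kineticE
  rw [hG]
  congr 2
  · refine setIntegral_congr_fun measurableSet_UHP fun y hy => ?_
    simp only [Set.indicator_of_mem hy]
  · refine setIntegral_congr_fun measurableSet_UHP fun y hy => ?_
    simp only [Set.indicator_of_mem hy]

lemma Good.inAdm {W : ℝ × ℝ → ℝ} (hW : Good W) {μ ν : ℝ} (h1 : ∫ x, W x ≤ ν)
    (h2 : ∫ x : ℝ × ℝ, x.2 * W x = μ) : InAdm μ ν W := by
  refine ⟨fun x _ => hW.nn x, hW.int.integrableOn, hW.int2.integrableOn, hW.int1.integrableOn,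
    ?_, ?_⟩
  · unfold impulse
    rw [hW.setInt (fun x hx => by rw [hx, mul_zero]), h2]
  · rwa [hW.setInt (fun x hx => hx)]

/-! ### Energy bounds -/

lemma le_of_sq_le_sq_tmp {a b : ℝ} (h : a ^ 2 ≤ b ^ 2) (hb : 0 ≤ b) : a ≤ b :=
  le_of_abs_le (abs_le_of_sq_le_sq h hb)

lemma Efun_upper {lam ν : ℝ} (hlam : 0 < lam) (hν : 0 < ν) :
    ∃ C : ℝ, ∀ W : ℝ × ℝ → ℝ, Good W → ∫ x, W x ≤ ν →
      Efun lam W ≤ C - (1 / (4 * lam)) * ∫ x, W x ^ 2 := by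
  set κ := ∫ x : ℝ × ℝ, K0 (rad x) ^ 2 with hκ
  have hκ0 : 0 ≤ κ := integral_nonneg fun _ => sq_nonneg _
  refine ⟨(1 / (4 * π)) * ((1 / 2) * (ν * ((lam * ν) * κ))), fun W hW hm => ?_⟩
  rw [hW.Efun_eq]
  have h1 : Qint id W ≤ _ := (hW.pair_bound (k := fun x => K0 (rad x))
    (K0_measurable.comp rad_measurable) (fun _ => K0_nonneg _) K0rad_sq_integrable
    measurable_id).2 (1 / (lam * ν)) (by positivity)
  have h2 := hW.Qint_nonneg (φ := reflPt)
  have hN : 0 ≤ ∫ x, W x ^ 2 := integral_nonneg fun _ => sq_nonneg _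
  rw [← hκ] at h1
  set N := ∫ x, W x ^ 2
  set m := ∫ x, W x
  have h3 : m * (1 / (lam * ν) * N + 1 / (1 / (lam * ν)) * κ)
      ≤ ν * (1 / (lam * ν) * N + 1 / (1 / (lam * ν)) * κ) := by
    gcongr
  have h4 : ν * (1 / (lam * ν) * N + 1 / (1 / (lam * ν)) * κ) = N / lam + ν * ((lam * ν) * κ) := by
    field_simp
  have h5 : Qint id W - Qint reflPt W ≤ (1 / 2) * (N / lam + ν * ((lam * ν) * κ)) := by
    linarith
  have h6 : (1 / (4 * π)) * (Qint id W - Qint reflPt W) ≤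
      (1 / (4 * π)) * ((1 / 2) * (N / lam + ν * ((lam * ν) * κ))) := by gcongr
  have h7 : (1 / (4 * π)) * ((1 / 2) * (N / lam)) ≤ (1 / (4 * lam)) * N := by
    have : (1 / (4 * π)) * ((1 / 2) * (N / lam)) = (1 / (2 * π)) * ((1 / (4 * lam)) * N) := by
      field_simp
    rw [this]
    have h8 : 1 / (2 * π) ≤ 1 := by
      rw [div_le_one (by positivity)]
      linarith [Real.pi_gt_three]
    have h9 : 0 ≤ (1 / (4 * lam)) * N := by positivity
    nlinarith
  have h10 : (1 / (2 * lam)) * N = 2 * ((1 / (4 * lam)) * N) := by field_simp; ring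
  rw [h10]
  nlinarith

lemma rad_sq (x : ℝ × ℝ) : rad x ^ 2 = x.1 ^ 2 + x.2 ^ 2 := Real.sq_sqrt (by positivity)

lemma esing_pointwise {s₀ R : ℝ} (hs₀ : 0 < s₀) (hR : 0 < R) :
    ∃ A : ℝ, 0 < A ∧ ∀ s, s₀ ≤ s → ∀ x ∈ UHP, ∀ y ∈ UHP,
      esing (x - y) ≤ A * (K0 (rad (reflPt x - y)) - K0 (rad (reflS s x - y)))
        + (1 / R) * (1 + x.2 + y.2) := by
  set τ := min s₀ (s₀ ^ 2 / (2 * R)) with hτ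
  have hτ0 : 0 < τ := by rw [hτ]; positivity
  have hτ1 : τ ≤ s₀ := min_le_left _ _
  have hτ2 : τ * (2 * R) ≤ s₀ ^ 2 := by
    have : τ ≤ s₀ ^ 2 / (2 * R) := min_le_right _ _
    rwa [le_div_iff₀ (by positivity)] at this
  have he : 0 < 1 - Real.exp (-τ) := by
    have : Real.exp (-τ) < 1 := by
      rw [← Real.exp_zero]; exact Real.exp_lt_exp.mpr (by linarith)
    linarith
  have hK := K0_pos (r := 2 * R) (by positivity)
  set d := (1 - Real.exp (-τ)) * K0 (2 * R) with hd
  have hd0 : 0 < d := by positivity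
  refine ⟨1 / d, by positivity, fun s hs x hx y hy => ?_⟩
  have hx' : 0 < x.2 := hx
  have hy' : 0 < y.2 := hy
  set a := rad (reflPt x - y) with ha
  set b := rad (reflS s x - y) with hb
  have ha2 : a ^ 2 = (x.1 - y.1) ^ 2 + (x.2 + y.2) ^ 2 := by
    rw [ha, rad_sq]; simp [reflPt]; ring
  have hb2 : b ^ 2 = (x.1 - y.1) ^ 2 + (x.2 + y.2 + 2 * s) ^ 2 := by
    rw [hb, rad_sq]; simp [reflS, reflPt]; ring
  have hr2 : rad (x - y) ^ 2 = (x.1 - y.1) ^ 2 + (x.2 - y.2) ^ 2 := by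
    rw [rad_sq]; simp
  have ha0 : 0 < a := by
    have h1 : 0 ≤ a := rad_nonneg _
    have h2 : a ≠ 0 := by
      intro h
      rw [h] at ha2
      nlinarith [sq_nonneg (x.1 - y.1)]
    exact lt_of_le_of_ne h1 h2.symm
  have hb0 : 0 ≤ b := rad_nonneg _
  have hab : a ≤ b := by
    refine le_of_sq_le_sq_tmp ?_ hb0
    rw [ha2, hb2]; nlinarith
  have hD0 : 0 ≤ K0 a - K0 b := sub_nonneg.mpr (K0_anti ha0 hab)
  have hAD : 0 ≤ 1 / d * (K0 a - K0 b) := by positivity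
  have hP : 0 ≤ (1 / R) * (1 + x.2 + y.2) := by positivity
  have he1 : esing (x - y) ≤ 1 := Real.exp_le_one_iff.mpr (by linarith [rad_nonneg (x - y)])
  rcases le_total R (x.2 + y.2) with h1 | h1
  · have : 1 ≤ (1 / R) * (1 + x.2 + y.2) := by
      rw [one_div, inv_mul_eq_div, le_div_iff₀ hR]; linarith
    linarith
  rcases le_total R (rad (x - y)) with h2 | h2
  · have h3 : esing (x - y) ≤ 1 / R := by
      unfold esing
      have h4 : Real.exp (-rad (x - y)) ≤ Real.exp (-R) := Real.exp_le_exp.mpr (by linarith)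
      refine h4.trans ?_
      rw [Real.exp_neg, one_div]
      have := Real.add_one_le_exp R
      exact inv_anti₀ hR (by linarith)
    have : 1 / R ≤ (1 / R) * (1 + x.2 + y.2) := by
      have : 0 < 1 / R := by positivity
      nlinarith
    linarith
  · have h3 : a ≤ 2 * R := by
      refine le_of_sq_le_sq_tmp ?_ (by positivity)
      have h4 : rad (x - y) ^ 2 ≤ R ^ 2 := by
        have := rad_nonneg (x - y)
        gcongr
      rw [ha2]
      nlinarith [sq_nonneg (x.2 - y.2)]
    have h4 : a + τ ≤ b := by
      refine le_of_sq_le_sq_tmp ?_ hb0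
      have h5 : τ * a ≤ τ * (2 * R) := by gcongr
      have h6 : τ ^ 2 ≤ s₀ ^ 2 := by gcongr
      have h7 : s₀ ^ 2 ≤ s ^ 2 := by gcongr
      have h8 : 0 ≤ (x.2 + y.2) * s := by
        have : 0 < s := by linarith
        positivity
      have : (a + τ) ^ 2 = a ^ 2 + 2 * (τ * a) + τ ^ 2 := by ring
      rw [this, ha2, hb2]
      nlinarith
    have h5 : K0 b ≤ Real.exp (-τ) * K0 a := (K0_anti (by linarith) h4).trans (K0_add_le ha0 hτ0.le)
    have h6 : K0 (2 * R) ≤ K0 a := K0_anti ha0 h3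
    have h7 : d ≤ K0 a - K0 b := by
      have h8 : d ≤ (1 - Real.exp (-τ)) * K0 a := mul_le_mul_of_nonneg_left h6 he.le
      have h9 : (1 - Real.exp (-τ)) * K0 a = K0 a - Real.exp (-τ) * K0 a := by ring
      linarith
    have h8 : 1 ≤ 1 / d * (K0 a - K0 b) := by
      rw [one_div, inv_mul_eq_div, le_div_iff₀ hd0]; linarith
    linarith

lemma int_comb {α : Type*} [MeasurableSpace α] {m : Measure α} {f g h a b c : α → ℝ}
    (hf : Integrable f m) (hg : Integrable g m) (hh : Integrable h m) (ha : Integrable a m)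
    (hb : Integrable b m) (hc : Integrable c m) (k₁ k₂ A r : ℝ) :
    Integrable (fun p => k₁ * f p + k₂ * (A * (g p - h p) + r * (a p + b p + c p))) m ∧
    ∫ p, (k₁ * f p + k₂ * (A * (g p - h p) + r * (a p + b p + c p))) ∂m =
      k₁ * (∫ p, f p ∂m) + k₂ * (A * ((∫ p, g p ∂m) - ∫ p, h p ∂m) +
        r * ((∫ p, a p ∂m) + (∫ p, b p ∂m) + ∫ p, c p ∂m)) := by
  have h1 : Integrable (fun p => g p - h p) m := hg.sub hh
  have h2 : Integrable (fun p => a p + b p) m := ha.add hb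
  have h3 : Integrable (fun p => a p + b p + c p) m := h2.add hc
  have h4 : Integrable (fun p => A * (g p - h p) + r * (a p + b p + c p)) m :=
    (h1.const_mul A).add (h3.const_mul r)
  refine ⟨(hf.const_mul k₁).add (h4.const_mul k₂), ?_⟩
  rw [integral_add (hf.const_mul k₁) (h4.const_mul k₂), integral_const_mul, integral_const_mul,
    integral_add (h1.const_mul A) (h3.const_mul r), integral_const_mul, integral_const_mul,
    integral_sub hg hh, integral_add h2 hc, integral_add ha hb]

lemma gain_lower {ν μ M c s₀ : ℝ} (hν : 0 < ν) (hμ : 0 < μ) (hM : 0 ≤ M) (hc : 0 < c)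
    (hs₀ : 0 < s₀) :
    ∃ δ : ℝ, 0 < δ ∧ ∀ W : ℝ × ℝ → ℝ, Good W → ∫ x, W x ≤ ν → ∫ x : ℝ × ℝ, x.2 * W x = μ →
      ∫ x, W x ^ 2 ≤ M → c ≤ Qint id W → ∀ s, s₀ ≤ s →
        δ ≤ Qint reflPt W - Qint (reflS s) W := by
  set Hs := ∫ x, hsing x ^ 2 with hHs
  have hHs0 : 0 ≤ Hs := integral_nonneg fun _ => sq_nonneg _
  set X := ν * (M + Hs) + 1 with hX
  have hX0 : 0 < X := by positivity
  set η := c / (4 * X) with hη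
  have hη0 : 0 < η := by positivity
  set Y := ν ^ 2 + 2 * μ * ν + 1 with hY
  have hY0 : 0 < Y := by positivity
  set R := 8 * Y / (η ^ 2 * c) with hRdef
  have hR0 : 0 < R := by positivity
  obtain ⟨A, hA, hAp⟩ := esing_pointwise hs₀ hR0
  refine ⟨c * η ^ 2 / (4 * A), by positivity, fun W hW hm hi h2 hE s hs => ?_⟩
  have i1 := hW.pair_bound hsing_measurable hsing_nonneg hsing_sq_integrable measurable_id
  have i2 := hW.Qint_integrable measurable_reflPt
  have i3 := hW.Qint_integrable (measurable_reflS s)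
  have i0 := hW.Qint_integrable measurable_id
  have j1 : Integrable (fun p : (ℝ × ℝ) × (ℝ × ℝ) => W p.1 * W p.2) := hW.int.mul_prod hW.int
  have j2 : Integrable (fun p : (ℝ × ℝ) × (ℝ × ℝ) => (p.1.2 * W p.1) * W p.2) :=
    hW.int1.mul_prod hW.int
  have j3 : Integrable (fun p : (ℝ × ℝ) × (ℝ × ℝ) => W p.1 * (p.2.2 * W p.2)) :=
    hW.int.mul_prod hW.int1
  have v1 : ∫ p : (ℝ × ℝ) × (ℝ × ℝ), W p.1 * W p.2 = (∫ x, W x) * ∫ x, W x :=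
    integral_prod_mul W W
  have v2 : ∫ p : (ℝ × ℝ) × (ℝ × ℝ), (p.1.2 * W p.1) * W p.2
      = (∫ x : ℝ × ℝ, x.2 * W x) * ∫ x, W x :=
    integral_prod_mul (fun x : ℝ × ℝ => x.2 * W x) W
  have v3 : ∫ p : (ℝ × ℝ) × (ℝ × ℝ), W p.1 * (p.2.2 * W p.2)
      = (∫ x, W x) * ∫ x : ℝ × ℝ, x.2 * W x :=
    integral_prod_mul W (fun x : ℝ × ℝ => x.2 * W x)
  have hpt : ∀ p : (ℝ × ℝ) × (ℝ × ℝ), W p.1 * W p.2 * K0 (rad (id p.1 - p.2)) ≤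
      (2 * η) * (W p.1 * W p.2 * hsing (id p.1 - p.2)) +
      (2 / η ^ 2) * (A * (W p.1 * W p.2 * K0 (rad (reflPt p.1 - p.2))
        - W p.1 * W p.2 * K0 (rad (reflS s p.1 - p.2)))
        + (1 / R) * (W p.1 * W p.2 + (p.1.2 * W p.1) * W p.2 + W p.1 * (p.2.2 * W p.2))) := by
    intro p
    by_cases hx : p.1 ∈ UHP
    swap
    · simp [hW.supp _ hx]
    by_cases hy : p.2 ∈ UHP
    swap
    · simp [hW.supp _ hy]
    have k1 := K0_split (id p.1 - p.2) hη0
    have k2 := hAp s hs p.1 hx p.2 hy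
    have k3 : 0 ≤ W p.1 * W p.2 := mul_nonneg (hW.nn _) (hW.nn _)
    have k4 : (1 / η ^ 2) * esing (id p.1 - p.2) ≤ (1 / η ^ 2) *
        (A * (K0 (rad (reflPt p.1 - p.2)) - K0 (rad (reflS s p.1 - p.2)))
        + (1 / R) * (1 + p.1.2 + p.2.2)) := by
      gcongr
      exact k2
    have k5 : K0 (rad (id p.1 - p.2)) ≤ 2 * (η * hsing (id p.1 - p.2) + (1 / η ^ 2) *
        (A * (K0 (rad (reflPt p.1 - p.2)) - K0 (rad (reflS s p.1 - p.2)))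
        + (1 / R) * (1 + p.1.2 + p.2.2))) := by linarith
    refine (mul_le_mul_of_nonneg_left k5 k3).trans (le_of_eq ?_)
    ring
  have hcomb := int_comb i1.1 i2 i3 j1 j2 j3 (2 * η) (2 / η ^ 2) A (1 / R)
  have hQle : Qint id W ≤ _ := integral_mono i0 hcomb.1 hpt
  have hint2 := hQle.trans (le_of_eq hcomb.2)
  rw [v1, v2, v3] at hint2
  change Qint id W ≤ (2 * η) * (∫ p : (ℝ × ℝ) × (ℝ × ℝ), W p.1 * W p.2 * hsing (id p.1 - p.2)) +
      (2 / η ^ 2) * (A * (Qint reflPt W - Qint (reflS s) W) + (1 / R) *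
        ((∫ x, W x) * (∫ x, W x) + (∫ x : ℝ × ℝ, x.2 * W x) * (∫ x, W x)
          + (∫ x, W x) * ∫ x : ℝ × ℝ, x.2 * W x)) at hint2
  rw [hi] at hint2
  have b1 := i1.2 1 one_pos
  rw [← hHs] at b1
  have hm0 : 0 ≤ ∫ x, W x := integral_nonneg hW.nn
  have hN0 : 0 ≤ ∫ x, W x ^ 2 := integral_nonneg fun _ => sq_nonneg _
  set m := ∫ x, W x
  set N := ∫ x, W x ^ 2
  set T := ∫ p : (ℝ × ℝ) × (ℝ × ℝ), W p.1 * W p.2 * hsing (id p.1 - p.2)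
  set Gn := Qint reflPt W - Qint (reflS s) W
  have b2 : T ≤ (1 / 2) * X := by
    have : m * (1 * N + 1 / 1 * Hs) ≤ ν * (1 * M + 1 / 1 * Hs) := by gcongr
    rw [hX]; linarith
  have b3 : (2 * η) * T ≤ c / 4 := by
    have : (2 * η) * T ≤ (2 * η) * ((1 / 2) * X) := by gcongr
    have h5 : (2 * η) * ((1 / 2) * X) = c / 4 := by rw [hη]; field_simp
    linarith
  have b4 : m * m + μ * m + m * μ ≤ Y := by
    have : m * m ≤ ν * ν := by gcongr
    have : μ * m ≤ μ * ν := by gcongr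
    rw [hY]; nlinarith
  have b5 : (2 / η ^ 2) * ((1 / R) * (m * m + μ * m + m * μ)) ≤ c / 4 := by
    have h4 : (2 / η ^ 2) * ((1 / R) * (m * m + μ * m + m * μ)) ≤ (2 / η ^ 2) * ((1 / R) * Y) := by
      gcongr
    have h5 : (2 / η ^ 2) * ((1 / R) * Y) = c / 4 := by
      rw [hRdef]; field_simp; norm_num
    linarith
  have b6 : c / 2 ≤ (2 / η ^ 2) * (A * Gn) := by
    rw [mul_add] at hint2
    linarith
  rw [div_le_iff₀ (by positivity)]
  have b7 : (2 / η ^ 2) * (A * Gn) = 2 * (A * Gn) / η ^ 2 := by ring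
  rw [b7, le_div_iff₀ (by positivity)] at b6
  linarith

/-! ### Positivity of the supremum -/

/-- A test box. -/
def box (L T : ℝ) : Set (ℝ × ℝ) := Set.Icc (-L) L ×ˢ Set.Icc T (T + 2 * L)

lemma measurableSet_box (L T : ℝ) : MeasurableSet (box L T) :=
  measurableSet_Icc.prod measurableSet_Icc

lemma volume_box {L : ℝ} (hL : 0 ≤ L) (T : ℝ) : volume (box L T) = ENNReal.ofReal (4 * L ^ 2) := by
  unfold box
  rw [Measure.volume_eq_prod, Measure.prod_prod, Real.volume_Icc, Real.volume_Icc,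
    ← ENNReal.ofReal_mul (by linarith)]
  congr 1; ring

/-- Its indicator function. -/
noncomputable def boxW (L T : ℝ) : ℝ × ℝ → ℝ := (box L T).indicator (fun _ => 1)

lemma boxW_of_mem {L T : ℝ} {x : ℝ × ℝ} (h : x ∈ box L T) : boxW L T x = 1 := by
  simp [boxW, h]

lemma boxW_of_notMem {L T : ℝ} {x : ℝ × ℝ} (h : x ∉ box L T) : boxW L T x = 0 := by
  simp [boxW, h]

lemma boxW_nonneg (L T : ℝ) (x : ℝ × ℝ) : 0 ≤ boxW L T x := by
  by_cases h : x ∈ box L T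
  · rw [boxW_of_mem h]; norm_num
  · rw [boxW_of_notMem h]

lemma boxW_integrable {L : ℝ} (hL : 0 ≤ L) (T : ℝ) : Integrable (boxW L T) := by
  unfold boxW
  rw [integrable_indicator_iff (measurableSet_box L T)]
  refine integrableOn_const ?_
  rw [volume_box hL]; exact ENNReal.ofReal_ne_top

lemma boxW_integral {L : ℝ} (hL : 0 ≤ L) (T : ℝ) : ∫ x, boxW L T x = 4 * L ^ 2 := by
  unfold boxW
  rw [integral_indicator (measurableSet_box L T)]
  simp only [integral_const, smul_eq_mul, mul_one, Measure.real, Measure.restrict_apply_univ]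
  rw [volume_box hL, ENNReal.toReal_ofReal (by positivity)]

lemma boxW_sq (L T : ℝ) : (fun x => boxW L T x ^ 2) = boxW L T := by
  funext x
  by_cases h : x ∈ box L T
  · rw [boxW_of_mem h]; norm_num
  · rw [boxW_of_notMem h]; norm_num

lemma boxW_good {L T : ℝ} (hL : 0 ≤ L) (hT : 0 < T) : Good (boxW L T) where
  nn := boxW_nonneg L T
  supp x hx := by
    apply boxW_of_notMem
    intro h
    exact hx (lt_of_lt_of_le hT h.2.1)
  int := boxW_integrable hL T
  int2 := by rw [boxW_sq]; exact boxW_integrable hL T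
  int1 := by
    refine Integrable.mono' ((boxW_integrable hL T).const_mul (T + 2 * L))
      (measurable_snd.aestronglyMeasurable.mul (boxW_integrable hL T).aestronglyMeasurable)
      (Eventually.of_forall fun x => ?_)
    by_cases h : x ∈ box L T
    · rw [boxW_of_mem h, mul_one, mul_one, Real.norm_of_nonneg (hT.le.trans h.2.1)]
      exact h.2.2
    · rw [boxW_of_notMem h]; simp

lemma boxW_impulse {L T : ℝ} (hL : 0 ≤ L) (hT : 0 < T) :
    T * (4 * L ^ 2) ≤ ∫ x : ℝ × ℝ, x.2 * boxW L T x := by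
  rw [← boxW_integral hL T, ← integral_const_mul]
  refine integral_mono ((boxW_integrable hL T).const_mul T) (boxW_good hL hT).int1 fun x => ?_
  by_cases h : x ∈ box L T
  · simp only [boxW_of_mem h, mul_one]; exact h.2.1
  · simp [boxW_of_notMem h]

lemma boxW_refl {L T : ℝ} (hL : 0 ≤ L) (hT : 0 < T) :
    Qint reflPt (boxW L T) ≤ (4 * L ^ 2) ^ 2 * K0 (2 * T) := by
  have hG := boxW_good hL hT
  have h1 : Integrable (fun p : (ℝ × ℝ) × (ℝ × ℝ) => boxW L T p.1 * boxW L T p.2 * K0 (2 * T)) :=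
    (hG.int.mul_prod hG.int).mul_const _
  have h2 : ∫ p : (ℝ × ℝ) × (ℝ × ℝ), boxW L T p.1 * boxW L T p.2 * K0 (2 * T)
      = (4 * L ^ 2) ^ 2 * K0 (2 * T) := by
    rw [integral_mul_const]
    congr 1
    have := integral_prod_mul (μ := (volume : Measure (ℝ × ℝ))) (ν := (volume : Measure (ℝ × ℝ)))
      (boxW L T) (boxW L T)
    rw [boxW_integral hL] at this
    rw [Measure.volume_eq_prod, this]; ring
  rw [← h2]
  refine integral_mono (hG.Qint_integrable measurable_reflPt) h1 fun p => ?_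
  simp only
  by_cases hx : p.1 ∈ box L T
  swap
  · simp [boxW_of_notMem hx]
  by_cases hy : p.2 ∈ box L T
  swap
  · simp [boxW_of_notMem hy]
  rw [boxW_of_mem hx, boxW_of_mem hy]
  simp only [one_mul]
  apply K0_anti (by positivity)
  refine le_of_sq_le_sq_tmp ?_ (rad_nonneg _)
  have hx2 : T ≤ p.1.2 := hx.2.1
  have hy2 : T ≤ p.2.2 := hy.2.1
  rw [rad_sq]
  simp only [reflPt, Prod.fst_sub, Prod.snd_sub]
  nlinarith [sq_nonneg (p.1.1 - p.2.1)]

/-- Centered square. -/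
def csq (R : ℝ) : Set (ℝ × ℝ) := Set.Icc (-R) R ×ˢ Set.Icc (-R) R

lemma measurableSet_csq (R : ℝ) : MeasurableSet (csq R) :=
  measurableSet_Icc.prod measurableSet_Icc

lemma boxW_id {L T R : ℝ} (hT : 0 < T) (hR : 0 ≤ R) (hRL : R ≤ L) :
    4 * (L - R) ^ 2 * (∫ x in csq R, K0 (rad x)) ≤ Qint id (boxW L T) := by
  have hG := boxW_good (hR.trans hRL) hT
  have hB := prod_int_shift (boxW_integrable (sub_nonneg.mpr hRL) (T + R))
    (K0rad_integrable.indicator (measurableSet_csq R))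
    ((K0_measurable.comp rad_measurable).indicator (measurableSet_csq R)) measurable_id
  rw [boxW_integral (sub_nonneg.mpr hRL), integral_indicator (measurableSet_csq R)] at hB
  rw [← hB.2]
  refine integral_mono hB.1 (hG.Qint_integrable measurable_id) fun p => ?_
  simp only
  have h0 : 0 ≤ boxW L T p.1 * boxW L T p.2 * K0 (rad (id p.1 - p.2)) :=
    mul_nonneg (mul_nonneg (boxW_nonneg _ _ _) (boxW_nonneg _ _ _)) (K0_nonneg _)
  by_cases hx : p.1 ∈ box (L - R) (T + R)
  swap
  · rw [boxW_of_notMem hx, zero_mul]; exact h0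
  by_cases hy : id p.1 - p.2 ∈ csq R
  swap
  · rw [Set.indicator_of_notMem hy, mul_zero]; exact h0
  rw [boxW_of_mem hx, Set.indicator_of_mem hy]
  obtain ⟨⟨a1, a2⟩, ⟨a3, a4⟩⟩ := hx
  obtain ⟨⟨b1, b2⟩, ⟨b3, b4⟩⟩ := hy
  simp only [id, Prod.fst_sub, Prod.snd_sub] at b1 b2 b3 b4
  have h1 : p.1 ∈ box L T := ⟨⟨by linarith, by linarith⟩, ⟨by linarith, by linarith⟩⟩
  have h2 : p.2 ∈ box L T := ⟨⟨by linarith, by linarith⟩, ⟨by linarith, by linarith⟩⟩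
  rw [boxW_of_mem h1, boxW_of_mem h2]
  simp

lemma exists_csq {q : ℝ} (hq : q < 2 * π) :
    ∃ R : ℝ, 0 ≤ R ∧ q < ∫ x in csq R, K0 (rad x) := by
  have hmono : Monotone (fun n : ℕ => csq (n : ℝ)) := by
    intro m n hmn
    have : (m : ℝ) ≤ n := by exact_mod_cast hmn
    exact Set.prod_mono (Set.Icc_subset_Icc (by linarith) this)
      (Set.Icc_subset_Icc (by linarith) this)
  have hU : ⋃ n : ℕ, csq (n : ℝ) = Set.univ := by
    rw [Set.eq_univ_iff_forall]
    intro x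
    obtain ⟨n, hn⟩ := exists_nat_ge (max |x.1| |x.2|)
    have h1 := abs_le.mp ((le_max_left _ _).trans hn)
    have h2 := abs_le.mp ((le_max_right _ _).trans hn)
    exact Set.mem_iUnion.mpr ⟨n, ⟨h1, h2⟩⟩
  have := tendsto_setIntegral_of_monotone (μ := volume) (f := fun x : ℝ × ℝ => K0 (rad x))
    (fun n : ℕ => measurableSet_csq (n : ℝ)) hmono K0rad_integrable.integrableOn
  rw [hU, setIntegral_univ, K0rad_integral] at this
  obtain ⟨n, hn⟩ := (this.eventually (lt_mem_nhds hq)).exists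
  exact ⟨n, by positivity, hn⟩

lemma K0_le_inv {T : ℝ} (hT : 1 ≤ T) : K0 (2 * T) ≤ 1 / T := by
  refine (K0_le (by linarith)).trans ?_
  have h1 : (2 * T) ^ (-(1 / 2) : ℝ) ≤ 1 :=
    Real.rpow_le_one_of_one_le_of_nonpos (by linarith) (by norm_num)
  have h2 : Real.exp (-(2 * T)) ≤ 1 / (2 * T) := by
    rw [Real.exp_neg, one_div]
    have := Real.add_one_le_exp (2 * T)
    exact inv_anti₀ (by linarith) (by linarith)
  calc Real.exp (-(2 * T)) * (2 * (2 * T) ^ (-(1 / 2) : ℝ)) ≤ (1 / (2 * T)) * (2 * 1) := by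
        gcongr
    _ = 1 / T := by field_simp

lemma Good.smul {W : ℝ × ℝ → ℝ} (hW : Good W) {c : ℝ} (hc : 0 ≤ c) :
    Good (fun x => c * W x) where
  nn x := mul_nonneg hc (hW.nn x)
  supp x hx := by rw [hW.supp x hx, mul_zero]
  int := hW.int.const_mul c
  int2 := by
    refine (hW.int2.const_mul (c ^ 2)).congr (Eventually.of_forall fun x => ?_)
    simp only; ring
  int1 := by
    refine (hW.int1.const_mul c).congr (Eventually.of_forall fun x => ?_)
    simp only; ring

lemma Qint_smul (φ : ℝ × ℝ → ℝ × ℝ) (W : ℝ × ℝ → ℝ) (c : ℝ) :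
    Qint φ (fun x => c * W x) = c ^ 2 * Qint φ W := by
  unfold Qint
  rw [← integral_const_mul]
  congr 1; funext p; ring

lemma Good.Efun_smul {W : ℝ × ℝ → ℝ} (hW : Good W) {c : ℝ} (hc : 0 ≤ c) (lam : ℝ) :
    Efun lam (fun x => c * W x) = c ^ 2 * Efun lam W := by
  rw [(hW.smul hc).Efun_eq, hW.Efun_eq, Qint_smul, Qint_smul]
  simp_rw [mul_pow]
  rw [integral_const_mul]; ring

lemma exists_pos {lam μ ν : ℝ} (hlam : 1 < lam) (hμ : 0 < μ) (hν : 0 < ν) :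
    ∃ ω, InAdm μ ν ω ∧ 0 < Efun lam ω := by
  have hπ := Real.pi_pos
  set q := 2 * π / lam with hq
  have hq0 : 0 < q := by positivity
  have hq1 : q < 2 * π := div_lt_self (by positivity) hlam
  obtain ⟨R, hR, hκ⟩ := exists_csq hq1
  set κ := ∫ x in csq R, K0 (rad x) with hκdef
  have hκq : 0 < κ - q := by linarith
  have hκ0 : 0 < κ := by linarith
  set L := 2 * R * κ / (κ - q) + R + 1 with hL
  have hL0 : 0 ≤ 2 * R * κ / (κ - q) := by positivity
  have hLR : R < L := by linarith
  have hLpos : 0 < L := by linarith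
  have hLk : 2 * R * κ < L * (κ - q) := by
    have h1 : 2 * R * κ / (κ - q) < L := by linarith
    rwa [div_lt_iff₀ hκq] at h1
  set g := 4 * (L - R) ^ 2 * κ - q * (4 * L ^ 2) with hg
  have hg0 : 0 < g := by
    have h1 : g = 4 * (L * (L * (κ - q) - 2 * R * κ) + R ^ 2 * κ) := by rw [hg]; ring
    rw [h1]
    have h2 : 0 < L * (L * (κ - q) - 2 * R * κ) := mul_pos hLpos (by linarith)
    positivity
  set T := 1 + μ / ν + (4 * L ^ 2) ^ 2 / g with hT
  have ht1 : 0 < μ / ν := by positivity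
  have ht2 : 0 < (4 * L ^ 2) ^ 2 / g := by positivity
  have hT1 : 1 ≤ T := by linarith
  have hT0 : 0 < T := by linarith
  have hTg : (4 * L ^ 2) ^ 2 * K0 (2 * T) < g := by
    have h1 : (4 * L ^ 2) ^ 2 * K0 (2 * T) ≤ (4 * L ^ 2) ^ 2 * (1 / T) := by
      gcongr; exact K0_le_inv hT1
    refine lt_of_le_of_lt h1 ?_
    rw [mul_one_div, div_lt_iff₀ hT0, mul_comm g T, ← div_lt_iff₀ hg0]
    linarith
  have hW := boxW_good hLpos.le hT0
  have hE : 0 < Efun lam (boxW L T) := by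
    rw [hW.Efun_eq, boxW_sq, boxW_integral hLpos.le]
    have h1 := boxW_id hT0 hR hLR.le
    have h2 := boxW_refl hLpos.le hT0
    have h3 : q * (4 * L ^ 2) < Qint id (boxW L T) - Qint reflPt (boxW L T) := by
      linarith
    have h4 : 1 / (2 * lam) * (4 * L ^ 2) = (1 / (4 * π)) * (q * (4 * L ^ 2)) := by
      rw [hq]; field_simp; try norm_num
    rw [h4, ← mul_sub]
    exact mul_pos (by positivity) (by linarith)
  have hI := boxW_impulse hLpos.le hT0
  set I := ∫ x : ℝ × ℝ, x.2 * boxW L T x with hIdef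
  have hI0 : 0 < I := lt_of_lt_of_le (by positivity) hI
  refine ⟨fun x => (μ / I) * boxW L T x, (hW.smul (by positivity)).inAdm ?_ ?_, ?_⟩
  · rw [integral_const_mul, boxW_integral hLpos.le, div_mul_eq_mul_div, div_le_iff₀ hI0]
    have h1 : μ ≤ ν * T := by
      have : μ / ν ≤ T := by linarith
      rw [div_le_iff₀ hν] at this; linarith
    calc μ * (4 * L ^ 2) ≤ (ν * T) * (4 * L ^ 2) := by gcongr
      _ = ν * (T * (4 * L ^ 2)) := by ring
      _ ≤ ν * I := by gcongr
  · have : ∀ x : ℝ × ℝ, x.2 * (μ / I * boxW L T x) = (μ / I) * (x.2 * boxW L T x) := by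
      intro x; ring
    simp_rw [this]
    rw [integral_const_mul, ← hIdef]
    field_simp
  · rw [hW.Efun_smul (by positivity)]
    positivity

lemma Sset_bdd {lam μ ν : ℝ} (hlam : 0 < lam) (hν : 0 < ν) :
    BddAbove {s | ∃ ω, InAdm μ ν ω ∧ s = Efun lam ω} := by
  obtain ⟨C, hC⟩ := Efun_upper hlam hν
  refine ⟨C, ?_⟩
  rintro _ ⟨ω, hω, rfl⟩
  have h1 := hC _ hω.good hω.indicator.1
  rw [Efun_indicator] at h1
  have : 0 ≤ (1 / (4 * lam)) * ∫ x, UHP.indicator ω x ^ 2 :=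
    mul_nonneg (by positivity) (integral_nonneg fun _ => sq_nonneg _)
  linarith

/-- strict monotonicity of `S_{μ,ν,λ}` in `μ`. -/
theorem stmt7 (lam ν μ₁ μ₂ : ℝ) (hlam : 1 < lam) (hν : 0 < ν)
    (hμ₁ : 0 < μ₁) (hμ : μ₁ < μ₂) (h : μ₁ * varrho lam ≤ ν) :
    Sval lam μ₁ ν < Sval lam μ₂ ν := by
  have hlam0 : 0 < lam := by linarith
  have hπ := Real.pi_pos
  obtain ⟨ω₀, hω₀, hE₀⟩ := exists_pos hlam hμ₁ hν
  have hS : 0 < Sval lam μ₁ ν := lt_of_lt_of_le hE₀ (le_csSup (Sset_bdd hlam0 hν) ⟨ω₀, hω₀, rfl⟩)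
  obtain ⟨C, hC⟩ := Efun_upper hlam0 hν
  have hM : 0 ≤ max (4 * lam * C) 0 := le_max_right _ _
  have hc : 0 < 4 * π * (Sval lam μ₁ ν / 2) := by positivity
  have hs₀ : 0 < (μ₂ - μ₁) / ν := div_pos (by linarith) hν
  obtain ⟨δ, hδ, hgain⟩ := gain_lower hν hμ₁ hM hc hs₀
  set ε := min (Sval lam μ₁ ν / 2) ((1 / (4 * π)) * δ) with hε
  have hε0 : 0 < ε := by rw [hε]; positivity
  have hε1 : ε ≤ Sval lam μ₁ ν / 2 := min_le_left _ _
  have hε2 : ε ≤ (1 / (4 * π)) * δ := min_le_right _ _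
  obtain ⟨_, ⟨ω, hω, rfl⟩, hlt⟩ := exists_lt_of_lt_csSup
    (s := {s | ∃ ω, InAdm μ₁ ν ω ∧ s = Efun lam ω}) ⟨_, ω₀, hω₀, rfl⟩
    (show Sval lam μ₁ ν - ε < Sval lam μ₁ ν by linarith)
  have hW := hω.good
  obtain ⟨hm, hi⟩ := hω.indicator
  rw [← Efun_indicator] at hlt
  set W := UHP.indicator ω with hWdef
  have hup := hC W hW hm
  have hN : ∫ x, W x ^ 2 ≤ max (4 * lam * C) 0 := by
    refine le_trans ?_ (le_max_left _ _)
    have h1 : (1 / (4 * lam)) * ∫ x, W x ^ 2 ≤ C := by linarith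
    rw [one_div, inv_mul_eq_div, div_le_iff₀ (by positivity)] at h1
    linarith
  have hQ : 4 * π * (Sval lam μ₁ ν / 2) ≤ Qint id W := by
    have h1 := hW.Efun_eq lam
    have h2 := hW.Qint_nonneg (φ := reflPt)
    have h3 : 0 ≤ (1 / (2 * lam)) * ∫ x, W x ^ 2 :=
      mul_nonneg (by positivity) (integral_nonneg fun _ => sq_nonneg _)
    have h4 : Sval lam μ₁ ν / 2 ≤ (1 / (4 * π)) * (Qint id W - Qint reflPt W) := by linarith
    rw [one_div, inv_mul_eq_div, le_div_iff₀ (by positivity)] at h4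
    linarith
  have hm0 : 0 < ∫ x, W x := by
    rcases (integral_nonneg hW.nn : 0 ≤ ∫ x, W x).eq_or_lt with h0 | h0
    · exfalso
      have h1 := (integral_eq_zero_iff_of_nonneg hW.nn hW.int).mp h0.symm
      have h2 : ∫ x : ℝ × ℝ, x.2 * W x = 0 := by
        apply integral_eq_zero_of_ae
        filter_upwards [h1] with x hx
        simp only [Pi.zero_apply] at hx ⊢
        rw [hx, mul_zero]
      linarith
    · exact h0
  set s := (μ₂ - μ₁) / ∫ x, W x with hs
  have hs1 : (μ₂ - μ₁) / ν ≤ s := div_le_div_of_nonneg_left (by linarith) hm0 hm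
  have hs0 : 0 ≤ s := hs₀.le.trans hs1
  have hg := hgain W hW hm hi hN hQ s hs1
  have hadm : InAdm μ₂ ν (shiftUp s W) := by
    refine (hW.shiftUp hs0).inAdm ?_ ?_
    · rw [shiftUp_int]; exact hm
    · rw [hW.shiftUp_int1, hi, hs, div_mul_cancel₀ _ hm0.ne']; ring
  have hle : Efun lam (shiftUp s W) ≤ Sval lam μ₂ ν :=
    le_csSup (Sset_bdd hlam0 hν) ⟨_, hadm, rfl⟩
  rw [hW.Efun_shiftUp lam hs0] at hle
  have h5 : (1 / (4 * π)) * δ ≤ (1 / (4 * π)) * (Qint reflPt W - Qint (reflS s) W) := by gcongr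
  linarith
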